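/- arXiv:2601.22170 — 2 statements merged into one kernel-verified Lean document; each statement's English description precedes it below -/
import Mathlib

section
/- Let V be a finite nonempty set, T > 0, and let Q : [0,T] → ℝ^{V×V} be a family of rate matrices with zero row sums, i.e. Σ_{j∈V} Q_{ij}(t) = 0 for all i and t. Suppose p : [0,T] → ℝ^V is strictly positive and solves the forward Kolmogorov equation d p(i,t)/dt = Σ_{k∈V} Q_{ki}(t) p(k,t) for all i ∈ V and t ∈ [0,T]. Define the reverse rates Q̄_{ij}(t) = Q_{ji}(t) · p(j,t)/p(i,t). Then the time-reversed marginals q(i,s) := p(i, T−s) satisfy, for all i ∈ V and s ∈ [0,T], the forward Kolmogorov equation for the reverse process: d q(i,s)/ds = Σ_{k≠i} Q̄_{ki}(T−s) q(k,s) − ( Σ_{ℓ≠i} Q̄_{iℓ}(T−s) ) q(i,s). In particular, the marginal law of the continuous-time Markov chain run backwards from p(·,T) with rates Q̄ coincides with p at every time. -/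
open Finset

/-- Positive weights turn the net flow of the reversed rates into minus the forward flow. -/
theorem reversed_net_flow_eq_neg {V : Type*} [Fintype V] [DecidableEq V]
    (A : Matrix V V ℝ) (w : V → ℝ) (hw : ∀ i, w i ≠ 0) (i : V) (hA : ∑ j, A i j = 0) :
    (∑ k ∈ Finset.univ.erase i, (A i k * w i / w k) * w k)
        - (∑ l ∈ Finset.univ.erase i, A l i * w l / w i) * w i
      = -∑ k, A k i * w k := by
  have hin : ∑ k ∈ Finset.univ.erase i, (A i k * w i / w k) * w k = -(A i i * w i) := by
    simp_rw [div_mul_cancel₀ _ (hw _), ← Finset.sum_mul]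
    rw [← Finset.add_sum_erase _ _ (Finset.mem_univ i)] at hA
    rw [eq_neg_of_add_eq_zero_right hA, neg_mul]
  rw [hin, ← Finset.sum_div, div_mul_cancel₀ _ (hw i),
    ← Finset.add_sum_erase _ (fun k => A k i * w k) (Finset.mem_univ i)]
  ring

/-- **Reversibility of continuous-time Markov chains in discrete state space.**
If the strictly positive marginals `p` solve the forward Kolmogorov equation
`d p(i,t)/dt = Σ_k Q_{ki}(t) p(k,t)` for rate matrices `Q(t)` with zero row sums, then the
time-reversed marginals `q(i,s) = p(i, T − s)` solve the forward Kolmogorov equation of the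
reverse process with rates `Q̄_{ij}(t) = Q_{ji}(t) p(j,t)/p(i,t)`:
`d q(i,s)/ds = Σ_{k≠i} Q̄_{ki}(T−s) q(k,s) − (Σ_{ℓ≠i} Q̄_{iℓ}(T−s)) q(i,s)`.
In particular the marginal law of the chain run backwards from `p(·,T)` with rates `Q̄`
coincides with `p` at every time.  Derivatives are one-sided at the endpoints of `[0,T]`,
which is expressed using `HasDerivWithinAt` on `Set.Icc 0 T`. -/
theorem ctmc_time_reversal {V : Type*} [Fintype V] [DecidableEq V] [Nonempty V]
    {T : ℝ} (hT : 0 < T)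
    (Q : ℝ → Matrix V V ℝ)
    (hrow : ∀ t ∈ Set.Icc (0:ℝ) T, ∀ i, ∑ j, Q t i j = 0)
    (p : ℝ → V → ℝ)
    (hpos : ∀ t ∈ Set.Icc (0:ℝ) T, ∀ i, 0 < p t i)
    (hode : ∀ i, ∀ t ∈ Set.Icc (0:ℝ) T,
      HasDerivWithinAt (fun s => p s i) (∑ k, Q t k i * p t k) (Set.Icc 0 T) t) :
    ∀ i, ∀ s ∈ Set.Icc (0:ℝ) T,
      HasDerivWithinAt (fun s' => p (T - s') i)
        ((∑ k ∈ Finset.univ.erase i,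
            (Q (T - s) i k * p (T - s) i / p (T - s) k) * p (T - s) k)
          - (∑ l ∈ Finset.univ.erase i,
              Q (T - s) l i * p (T - s) l / p (T - s) i) * p (T - s) i)
        (Set.Icc 0 T) s := by
  intro i s hs
  have hmaps : Set.MapsTo (fun s' => T - s') (Set.Icc 0 T) (Set.Icc 0 T) :=
    fun x hx => ⟨sub_nonneg.2 hx.2, sub_le_self T hx.1⟩
  have ht := hmaps hs
  rw [reversed_net_flow_eq_neg (Q (T - s)) (p (T - s)) (fun k => (hpos _ ht k).ne') i
    (hrow _ ht i), ← mul_neg_one]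
  exact (hode i _ ht).comp s ((hasDerivAt_id s).const_sub T).hasDerivWithinAt hmaps
end

section
/- Let F be a finite set with at least two elements and let p be a probability mass function on F with full support. Consider the score-entropy objective on positive off-diagonal matrices S : F × F → (0,∞): L(S) = Σ_{i∈F} p(i) Σ_{j≠i} ( S(i,j) − (p(j)/p(i)) · log S(i,j) ). Then L attains its unique minimum over all such S at S*(i,j) = p(j)/p(i) for all i ≠ j; that is, L(S) ≥ L(S*) for all S with S(i,j) > 0 for i ≠ j, with equality if and only if S(i,j) = p(j)/p(i) for all i ≠ j. -/
open Finset

/-- The score-entropy objective: `L(S) = Σ_i p(i) Σ_{j≠i} (S(i,j) − (p(j)/p(i)) log S(i,j))`. -/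
noncomputable def scoreEntropy {F : Type*} [Fintype F] [DecidableEq F]
    (p : F → ℝ) (S : F → F → ℝ) : ℝ :=
  ∑ i, p i * ∑ j ∈ Finset.univ.erase i, (S i j - (p j / p i) * Real.log (S i j))

/-- For `0 < a`, the map `s ↦ s - a * log s` on `(0, ∞)` is minimized only at `s = a`. -/
theorem sub_mul_log_self_lt {a s : ℝ} (ha : 0 < a) (hs : 0 < s) (hne : s ≠ a) :
    a - a * Real.log a < s - a * Real.log s := by
  have h := Real.log_lt_sub_one_of_pos (div_pos hs ha) (by rwa [Ne, div_eq_one_iff_eq ha.ne'])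
  rw [Real.log_div hs.ne' ha.ne'] at h
  have h' := mul_lt_mul_of_pos_left h ha
  rw [mul_sub, mul_sub, mul_div_cancel₀ _ ha.ne'] at h'
  linarith

theorem sub_mul_log_self_le {a s : ℝ} (ha : 0 < a) (hs : 0 < s) :
    a - a * Real.log a ≤ s - a * Real.log s := by
  rcases eq_or_ne s a with rfl | hne
  · exact le_rfl
  · exact (sub_mul_log_self_lt ha hs hne).le

theorem sub_mul_log_self_eq_iff {a s : ℝ} (ha : 0 < a) (hs : 0 < s) :
    a - a * Real.log a = s - a * Real.log s ↔ s = a := by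
  refine ⟨fun h => ?_, fun h => by rw [h]⟩
  by_contra hne
  exact (sub_mul_log_self_lt ha hs hne).ne h

/-- **The score-entropy objective is uniquely minimized at the true probability ratios.**
For a full-support pmf `p` on a finite set with at least two elements, and any `S` with
strictly positive off-diagonal entries, `L(S) ≥ L(S*)` where `S*(i,j) = p(j)/p(i)`, with
equality iff `S(i,j) = p(j)/p(i)` for all `i ≠ j`. -/
theorem scoreEntropy_minimizer {F : Type*} [Fintype F] [DecidableEq F]
    (hF : 2 ≤ Fintype.card F)
    (p : F → ℝ) (hp : ∀ i, 0 < p i) (hps : ∑ i, p i = 1)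
    (S : F → F → ℝ) (hS : ∀ i j, i ≠ j → 0 < S i j) :
    scoreEntropy p (fun i j => p j / p i) ≤ scoreEntropy p S ∧
    (scoreEntropy p S = scoreEntropy p (fun i j => p j / p i) ↔
      ∀ i j, i ≠ j → S i j = p j / p i) := by
  have hle : ∀ i, ∀ j ∈ univ.erase i, p j / p i - p j / p i * Real.log (p j / p i) ≤
      S i j - p j / p i * Real.log (S i j) := fun i j hj =>
    sub_mul_log_self_le (div_pos (hp j) (hp i)) (hS i j (ne_of_mem_erase hj).symm)
  have hrow : ∀ i ∈ univ,
      p i * ∑ j ∈ univ.erase i, (p j / p i - p j / p i * Real.log (p j / p i)) ≤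
        p i * ∑ j ∈ univ.erase i, (S i j - p j / p i * Real.log (S i j)) := fun i _ =>
    mul_le_mul_of_nonneg_left (sum_le_sum (hle i)) (hp i).le
  refine ⟨sum_le_sum hrow, ?_⟩
  rw [eq_comm, scoreEntropy, scoreEntropy, sum_eq_sum_iff_of_le hrow]
  simp only [mem_univ, true_imp_iff, mul_right_inj' (hp _).ne']
  refine forall_congr' fun i => ?_
  rw [sum_eq_sum_iff_of_le (hle i)]
  refine forall_congr' fun j => ?_
  rw [mem_erase, and_iff_left (mem_univ j), ne_comm]
  exact imp_congr_right fun hij =>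
    sub_mul_log_self_eq_iff (div_pos (hp j) (hp i)) (hS i j hij)
end
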